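/- For every simplicial group G there is a natural isomorphism of simplicial sets W̄G ≅ Tot(NG), where NG is the bisimplicial set obtained by applying the nerve functor dimensionwise to G. -/

import Mathlib

namespace Paper

/-- clamped coface map `δ^k : [a] → [b]`. -/
def δOH (k a b : ℕ) : Fin (a+1) →o Fin (b+1) where
  toFun i := ⟨min (if (i:ℕ) < k then (i:ℕ) else (i:ℕ)+1) b, Nat.lt_succ_of_le (Nat.min_le_right _ _)⟩
  monotone' := by
    intro i j hij
    have h : (i:ℕ) ≤ (j:ℕ) := hij
    simp only [Fin.mk_le_mk]
    split_ifs <;> omega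

/-- clamped codegeneracy map `σ^k : [a] → [b]`. -/
def σOH (k a b : ℕ) : Fin (a+1) →o Fin (b+1) where
  toFun i := ⟨min (if (i:ℕ) ≤ k then (i:ℕ) else (i:ℕ)-1) b, Nat.lt_succ_of_le (Nat.min_le_right _ _)⟩
  monotone' := by
    intro i j hij
    have h : (i:ℕ) ≤ (j:ℕ) := hij
    simp only [Fin.mk_le_mk]
    split_ifs <;> omega

/-- `τ^k : [n] → [1]`, sending `[0, n-k]` to `0` and the rest to `1`. -/
def τOH (n k : ℕ) : Fin (n+1) →o Fin 2 where
  toFun i := if (i:ℕ) + k ≤ n then 0 else 1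
  monotone' := by
    intro i j hij
    have h : (i:ℕ) ≤ (j:ℕ) := hij
    dsimp only
    split_ifs with h1 h2 h3
    · exact le_refl _
    · exact Fin.zero_le _
    · exact absurd h3 (by omega)
    · exact le_refl _

/-- application of `θ : [m] → [n]` to a natural number (clamped). -/
def fApp {m n : ℕ} (θ : Fin (m+1) →o Fin (n+1)) (x : ℕ) : ℕ :=
  (θ ⟨min x m, Nat.lt_succ_of_le (Nat.min_le_right _ _)⟩ : Fin (n+1))

theorem fApp_mono {m n : ℕ} (θ : Fin (m+1) →o Fin (n+1)) {x y : ℕ} (h : x ≤ y) :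
    fApp θ x ≤ fApp θ y :=
  Fin.le_def.mp (θ.monotone (Fin.mk_le_mk.mpr (by omega)))

theorem fApp_le {m n : ℕ} (θ : Fin (m+1) →o Fin (n+1)) (x : ℕ) : fApp θ x ≤ n :=
  Nat.lt_succ_iff.mp (Fin.isLt _)

theorem fApp_coe {m n : ℕ} (θ : Fin (m+1) →o Fin (n+1)) (p : Fin (m+1)) :
    fApp θ (p:ℕ) = (θ p : ℕ) := by
  have hp : (⟨min (p:ℕ) m, Nat.lt_succ_of_le (Nat.min_le_right _ _)⟩ : Fin (m+1)) = p :=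
    Fin.ext (show min (p:ℕ) m = (p:ℕ) from by have := p.isLt; omega)
  unfold fApp
  rw [hp]

/-- `Spl_{≤ p}(θ) : [p] → [pθ]`. -/
def splLe {m n : ℕ} (θ : Fin (m+1) →o Fin (n+1)) (p : Fin (m+1)) :
    Fin ((p:ℕ)+1) →o Fin ((θ p : ℕ)+1) where
  toFun i := ⟨fApp θ (i:ℕ), by
    have h1 : fApp θ (i:ℕ) ≤ fApp θ (p:ℕ) := fApp_mono θ (by have := i.isLt; omega)
    have h2 : fApp θ (p:ℕ) = (θ p : ℕ) := fApp_coe θ p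
    omega⟩
  monotone' := by
    intro a b hab
    have h : (a:ℕ) ≤ (b:ℕ) := hab
    simp only [Fin.mk_le_mk]
    exact fApp_mono θ h

/-- `Spl_{≥ p}(θ) : [m-p] → [n-pθ]`. -/
def splGe {m n : ℕ} (θ : Fin (m+1) →o Fin (n+1)) (p : Fin (m+1)) :
    Fin (m - (p:ℕ) + 1) →o Fin (n - (θ p : ℕ) + 1) where
  toFun i := ⟨fApp θ ((i:ℕ) + (p:ℕ)) - (θ p : ℕ), by
    have h1 : fApp θ ((i:ℕ) + (p:ℕ)) ≤ n := fApp_le θ _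
    omega⟩
  monotone' := by
    intro a b hab
    have h : (a:ℕ) ≤ (b:ℕ) := hab
    simp only [Fin.mk_le_mk]
    have := fApp_mono θ (show (a:ℕ) + (p:ℕ) ≤ (b:ℕ) + (p:ℕ) by omega)
    omega

/-- the restriction `θ|_[i]^[j] : [i] → [j]` of `θ` (clamped). -/
def restrictOH {m n : ℕ} (θ : Fin (m+1) →o Fin (n+1)) (i j : ℕ) : Fin (i+1) →o Fin (j+1) where
  toFun k := ⟨min (fApp θ (k:ℕ)) j, Nat.lt_succ_of_le (Nat.min_le_right _ _)⟩
  monotone' := by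
    intro a b hab
    have h : (a:ℕ) ≤ (b:ℕ) := hab
    simp only [Fin.mk_le_mk]
    have := fApp_mono θ h
    omega

/-- ascending product `f a * f (a+1) * ⋯ * f (b-1)`. -/
def aProd {γ : Type*} [Monoid γ] (f : ℕ → γ) (a : ℕ) : ℕ → γ
  | 0 => 1
  | b+1 => if a ≤ b then aProd f a b * f b else 1

/-- descending product `f (b-1) * f (b-2) * ⋯ * f a`. -/
def dProd {γ : Type*} [Monoid γ] (f : ℕ → γ) (a : ℕ) : ℕ → γ
  | 0 => 1
  | b+1 => if a ≤ b then f b * dProd f a b else 1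

end Paper
namespace Paper

/-- A simplicial group, given by levels, structure maps, functoriality,
and levelwise multiplicativity. -/
structure SGrp where
  obj : ℕ → Type
  grp : ∀ n, Group (obj n)
  map : ∀ {m n : ℕ}, (Fin (m+1) →o Fin (n+1)) → obj n → obj m
  map_id : ∀ {n : ℕ} (x : obj n), map OrderHom.id x = x
  map_comp : ∀ {l m n : ℕ} (α : Fin (l+1) →o Fin (m+1)) (β : Fin (m+1) →o Fin (n+1)) (x : obj n),
    map α (map β x) = map (β.comp α) x
  map_mul : ∀ {m n : ℕ} (θ : Fin (m+1) →o Fin (n+1)) (x y : obj n),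
    map θ (x * y) = map θ x * map θ y

attribute [instance] SGrp.grp

namespace SGrp

/-- face `d_k : G_N → G_{N-1}` -/
def face (G : SGrp) (k : ℕ) {N : ℕ} : G.obj N → G.obj (N-1) := G.map (δOH k (N-1) N)

/-- degeneracy `s_k : G_M → G_{M+1}` -/
def deg (G : SGrp) (k : ℕ) {M : ℕ} : G.obj M → G.obj (M+1) := G.map (σOH k (M+1) M)

/-- transport between levels (junk value `1` when levels differ). -/
def gcast (G : SGrp) {a : ℕ} (b : ℕ) (x : G.obj a) : G.obj b := if h : a = b then h ▸ x else 1

/-- descending composite of faces `d_{i+c} d_{i+c-1} ⋯ d_{i+1}`. -/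
def dcomp (G : SGrp) : (i c : ℕ) → {N : ℕ} → G.obj N → G.obj (N - c)
  | _, 0, _, x => x
  | i, c+1, _, x => G.face (i+1) (G.dcomp (i+1) c x)

/-- ascending composite of degeneracies `s_i s_{i+1} ⋯ s_{i+c-1}`. -/
def scomp (G : SGrp) : (i c : ℕ) → {M : ℕ} → G.obj M → G.obj (M + c)
  | _, 0, _, x => x
  | i, c+1, _, x => G.deg (i+c) (G.scomp i c x)

/-- `x ↦ x d_j ⋯ d_{i+1} s_i ⋯ s_{j-1}`, an endomap of `G_N`. -/
def ds (G : SGrp) (i j : ℕ) {N : ℕ} (x : G.obj N) : G.obj N :=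
  G.gcast N (G.scomp i (min (j - i) N) (G.dcomp i (min (j - i) N) x))

/-- `x ↦ x d_j ⋯ d_{i+1} s_i ⋯ s_{n-1} : G_j → G_n`. -/
def dsTo (G : SGrp) (i n : ℕ) {j : ℕ} (x : G.obj j) : G.obj n :=
  G.gcast n (G.scomp i (n - i) (G.gcast i (G.dcomp i (j - i) x)))

/-- the `y_i` of the section `S_G`, defined by descending recursion (with fuel). -/
def yAux (G : SGrp) (n : ℕ) (g : ∀ j : ℕ, G.obj j) : ℕ → ℕ → G.obj n
  | 0, _ => 1
  | fuel+1, i =>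
      aProd (fun j => G.ds i j (G.yAux n g fuel j)⁻¹) (i+1) n *
      dProd (fun j => G.dsTo i n (g j)) i n

/-- `W̄_n G = ∏_{j = n-1}^{0} G_j`. -/
def WbarN (G : SGrp) (n : ℕ) : Type := ∀ j : Fin n, G.obj (j:ℕ)

/-- extension of a tuple in `W̄_n G` by `1`. -/
def gE (G : SGrp) {n : ℕ} (g : G.WbarN n) : ∀ j : ℕ, G.obj j :=
  fun j => if h : j < n then g ⟨j, h⟩ else 1

/-- the coretraction `(S_G)_n : W̄_n G → Diag_n NG = (G_n)^n`. -/
def SGn (G : SGrp) (n : ℕ) (g : G.WbarN n) : Fin n → G.obj n :=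
  fun i => G.yAux n (G.gE g) n (i:ℕ)

/-- extension of a tuple in `(G_n)^n` by `1`. -/
def xE (G : SGrp) {n : ℕ} (x : Fin n → G.obj n) : ℕ → G.obj n :=
  fun j => if h : j < n then x ⟨j, h⟩ else 1

/-- the structure map `W̄_θ : W̄_n G → W̄_m G` of the Kan classifying simplicial set. -/
def wbarMap (G : SGrp) {m n : ℕ} (θ : Fin (m+1) →o Fin (n+1)) (g : G.WbarN n) : G.WbarN m :=
  fun i => dProd (fun j => G.map (restrictOH θ (i:ℕ) j) (G.gE g j))
    ((θ i.castSucc : Fin (n+1)) : ℕ) ((θ i.succ : Fin (n+1)) : ℕ)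

/-- the structure map `(Diag NG)_θ : (G_n)^n → (G_m)^m` of the diagonal of the nerve. -/
def diagMap (G : SGrp) {m n : ℕ} (θ : Fin (m+1) →o Fin (n+1)) (x : Fin n → G.obj n) :
    Fin m → G.obj m :=
  fun i => dProd (fun j => G.map θ (G.xE x j))
    ((θ i.castSucc : Fin (n+1)) : ℕ) ((θ i.succ : Fin (n+1)) : ℕ)

/-- the retraction `(D_G)_n : Diag_n NG → W̄_n G`, `(g_i)_i ↦ (g_i d_n ⋯ d_{i+1})_i`. -/
def DGn (G : SGrp) (n : ℕ) (x : Fin n → G.obj n) : G.WbarN n :=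
  fun i => G.gcast (i:ℕ) (G.dcomp (i:ℕ) (n - (i:ℕ)) (x i))

/-- the components `y_i^{(n+1-k)}` of the homotopy `H`, by descending recursion (with fuel). -/
def hAux (G : SGrp) (n k : ℕ) (g : ℕ → G.obj n) : ℕ → ℕ → G.obj n
  | 0, _ => 1
  | fuel+1, i =>
      if k ≤ i + 1 then g i
      else
        aProd (fun j => G.ds i j (G.hAux n k g fuel j)⁻¹) (i+1) (k-1) *
        dProd (fun j => G.ds i (k-1) (g j)) i (k-1)

end SGrp

/-- recover `k` from the simplex `τ^{n+1-k} ∈ Δ^1_n`: the number of vertices sent to `0`. -/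
def kOf {n : ℕ} (t : Fin (n+1) →o Fin 2) : ℕ :=
  (Finset.univ.filter (fun i => t i = 0)).card

namespace SGrp

/-- the homotopy `H_n : Diag_n NG × Δ^1_n → Diag_n NG`. -/
def Hn (G : SGrp) (n : ℕ) (x : Fin n → G.obj n) (t : Fin (n+1) →o Fin 2) : Fin n → G.obj n :=
  fun i => G.hAux n (kOf t) (G.xE x) (n+1) (i:ℕ)

end SGrp

/-- morphisms of simplicial groups. -/
structure SGrpHom (G G' : SGrp) where
  app : ∀ n, G.obj n → G'.obj n
  comm : ∀ {m n : ℕ} (θ : Fin (m+1) →o Fin (n+1)) (x : G.obj n),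
    app m (G.map θ x) = G'.map θ (app n x)
  mul : ∀ (n : ℕ) (x y : G.obj n), app n (x * y) = app n x * app n y

end Paper
namespace Paper

/-- the levels `(NG)_{p,q} = (G_q)^p` of the dimensionwise nerve of a simplicial group. -/
def ngObj (G : SGrp) (p q : ℕ) : Type := Fin p → G.obj q

/-- the structure maps of the bisimplicial set `NG`: the nerve of the group in the
horizontal direction, the simplicial structure of `G` in the vertical direction. -/
def ngMap (G : SGrp) {p p' q q' : ℕ} (α : Fin (p+1) →o Fin (p'+1)) (β : Fin (q+1) →o Fin (q'+1))
    (x : ngObj G p' q') : ngObj G p q :=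
  fun i => dProd (fun j => G.map β (if h : j < p' then x ⟨j, h⟩ else 1))
    ((α i.castSucc : Fin (p'+1)) : ℕ) ((α i.succ : Fin (p'+1)) : ℕ)

/-- the condition defining `Tot_n (NG)`. -/
def ngTotCond (G : SGrp) (n : ℕ) (x : ∀ q : Fin (n+1), ngObj G (q:ℕ) (n - (q:ℕ))) : Prop :=
  ∀ (q : ℕ) (h : q + 1 ≤ n),
    ngMap G (δOH (q+1) q (q+1)) OrderHom.id (x ⟨q+1, by omega⟩) =
    ngMap G OrderHom.id (δOH 0 (n - (q+1)) (n - q)) (x ⟨q, by omega⟩)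

/-- the structure maps of `Tot (NG)`, via the splittings. -/
def ngTotRaw (G : SGrp) {m n : ℕ} (θ : Fin (m+1) →o Fin (n+1))
    (x : ∀ q : Fin (n+1), ngObj G (q:ℕ) (n - (q:ℕ))) :
    ∀ p : Fin (m+1), ngObj G (p:ℕ) (m - (p:ℕ)) :=
  fun p => ngMap G (splLe θ p) (splGe θ p) (x (θ p))

end Paper

namespace Paper

section Products

variable {γ : Type*}

theorem dProd_of_le [Monoid γ] (f : ℕ → γ) {a b : ℕ} (h : b ≤ a) : dProd f a b = 1 := by
  cases b with
  | zero => rfl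
  | succ b => simp [dProd, show ¬ a ≤ b by omega]

theorem dProd_succ [Monoid γ] (f : ℕ → γ) {a b : ℕ} (h : a ≤ b) :
    dProd f a (b + 1) = f b * dProd f a b := by
  simp [dProd, h]

theorem dProd_congr [Monoid γ] {f g : ℕ → γ} {a b : ℕ}
    (h : ∀ j, a ≤ j → j < b → f j = g j) : dProd f a b = dProd g a b := by
  induction b with
  | zero => rfl
  | succ b ih =>
    by_cases hab : a ≤ b
    · rw [dProd_succ f hab, dProd_succ g hab, h b hab (by omega),
        ih fun j h1 h2 => h j h1 (by omega)]
    · rw [dProd_of_le f (by omega), dProd_of_le g (by omega)]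

theorem dProd_mul_dProd [Monoid γ] (f : ℕ → γ) {a b c : ℕ} (hab : a ≤ b) (hbc : b ≤ c) :
    dProd f b c * dProd f a b = dProd f a c := by
  induction c, hbc using Nat.le_induction with
  | base => rw [dProd_of_le f le_rfl, one_mul]
  | succ c hc ih => rw [dProd_succ f hc, dProd_succ f (hab.trans hc), mul_assoc, ih]

theorem dProd_singleton [Monoid γ] (f : ℕ → γ) (a : ℕ) : dProd f a (a + 1) = f a := by
  rw [dProd_succ f le_rfl, dProd_of_le f le_rfl, mul_one]

theorem dProd_telescope [Group γ] {f h : ℕ → γ} {a b : ℕ} (hab : a ≤ b)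
    (hf : ∀ j, a ≤ j → j < b → f j = (h (j + 1))⁻¹ * h j) :
    dProd f a b = (h b)⁻¹ * h a := by
  induction b, hab using Nat.le_induction with
  | base => rw [dProd_of_le f le_rfl, inv_mul_cancel]
  | succ b hb ih =>
    rw [dProd_succ f hb, ih fun j h1 h2 => hf j h1 (by omega), hf b hb (by omega)]
    group

theorem map_dProd {δ : Type*} [Monoid γ] [Monoid δ] (φ : γ →* δ) (f : ℕ → γ) (a b : ℕ) :
    φ (dProd f a b) = dProd (fun j => φ (f j)) a b := by
  induction b with
  | zero => exact map_one φ
  | succ b ih =>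
    by_cases hab : a ≤ b
    · rw [dProd_succ _ hab, dProd_succ _ hab, map_mul, ih]
    · rw [dProd_of_le _ (by omega), dProd_of_le _ (by omega), map_one]

end Products

theorem fApp_comp {l m n : ℕ} (α : Fin (l + 1) →o Fin (m + 1)) (β : Fin (m + 1) →o Fin (n + 1))
    (v : ℕ) : fApp (β.comp α) v = fApp β (fApp α v) := by
  unfold fApp
  simp only [OrderHom.comp_coe, Function.comp_apply]
  congr 2
  ext
  simp only
  omega

theorem fApp_id {n v : ℕ} (h : v ≤ n) :
    fApp (OrderHom.id : Fin (n + 1) →o Fin (n + 1)) v = v := by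
  simp [fApp, h]

theorem fApp_of_le {m n v : ℕ} (θ : Fin (m + 1) →o Fin (n + 1)) (h : v ≤ m) :
    fApp θ v = (θ ⟨v, by omega⟩ : ℕ) :=
  fApp_coe θ ⟨v, by omega⟩

theorem fApp_δOH {k a b v : ℕ} (h : v ≤ a) :
    fApp (δOH k a b) v = min (if v < k then v else v + 1) b := by
  rw [fApp_of_le _ h]; rfl

theorem fApp_σOH {k a b v : ℕ} (h : v ≤ a) :
    fApp (σOH k a b) v = min (if v ≤ k then v else v - 1) b := by
  rw [fApp_of_le _ h]; rfl

/-- Monotone maps of finite ordinals are determined by their values on natural numbers. -/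
theorem orderHom_ext_fApp {m n : ℕ} {α β : Fin (m + 1) →o Fin (n + 1)}
    (h : ∀ v ≤ m, fApp α v = fApp β v) : α = β := by
  ext i
  rw [← fApp_coe, ← fApp_coe]
  exact h i (by omega)

/-- The clamped inclusion `[v] → [n]` of an initial segment. -/
def initial (v n : ℕ) : Fin (v + 1) →o Fin (n + 1) where
  toFun i := ⟨min (i : ℕ) n, by omega⟩
  monotone' := by
    intro a b hab
    have h : (a : ℕ) ≤ (b : ℕ) := hab
    simp only [Fin.mk_le_mk]
    omega

theorem fApp_initial {v n w : ℕ} (h : w ≤ v) : fApp (initial v n) w = min w n := by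
  rw [fApp_of_le _ h]; rfl

/-- The inclusion `[n - q] → [n - p]`, `c ↦ c + (q - p)`, of a final segment (clamped). -/
def final (n q p : ℕ) : Fin (n - q + 1) →o Fin (n - p + 1) where
  toFun i := ⟨min ((i : ℕ) + (q - p)) (n - p), by omega⟩
  monotone' := by
    intro a b hab
    have h : (a : ℕ) ≤ (b : ℕ) := hab
    simp only [Fin.mk_le_mk]
    omega

theorem fApp_final {n q p w : ℕ} (h : w ≤ n - q) :
    fApp (final n q p) w = min (w + (q - p)) (n - p) := by
  rw [fApp_of_le _ h]; rfl

/-- The retraction `[n] → [n - q]`, `c ↦ c - q`, of the inclusion of a final segment. -/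
def collapse (n q : ℕ) : Fin (n + 1) →o Fin (n - q + 1) where
  toFun i := ⟨(i : ℕ) - q, by omega⟩
  monotone' := by
    intro a b hab
    have h : (a : ℕ) ≤ (b : ℕ) := hab
    simp only [Fin.mk_le_mk]
    omega

theorem fApp_collapse {n q w : ℕ} (h : w ≤ n) : fApp (collapse n q) w = w - q := by
  rw [fApp_of_le _ h]; rfl

theorem fApp_restrictOH {m n i j w : ℕ} (θ : Fin (m + 1) →o Fin (n + 1)) (h : w ≤ i) :
    fApp (restrictOH θ i j) w = min (fApp θ w) j := by
  rw [fApp_of_le _ h]; rfl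

theorem fApp_splGe {m n w : ℕ} (θ : Fin (m + 1) →o Fin (n + 1)) (p : Fin (m + 1))
    (h : w ≤ m - p) : fApp (splGe θ p) w = fApp θ (w + p) - fApp θ p := by
  rw [fApp_of_le _ h, fApp_coe]; rfl

namespace SGrp

variable (G : SGrp)

/-- A structure map of a simplicial group, as a homomorphism. -/
def mapHom {m n : ℕ} (θ : Fin (m + 1) →o Fin (n + 1)) : G.obj n →* G.obj m :=
  MonoidHom.mk' (G.map θ) (G.map_mul θ)

theorem map_one' {m n : ℕ} (θ : Fin (m + 1) →o Fin (n + 1)) : G.map θ 1 = 1 :=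
  map_one (G.mapHom θ)

theorem map_inv' {m n : ℕ} (θ : Fin (m + 1) →o Fin (n + 1)) (x : G.obj n) :
    G.map θ x⁻¹ = (G.map θ x)⁻¹ :=
  map_inv (G.mapHom θ) x

theorem map_dProd' {m n : ℕ} (θ : Fin (m + 1) →o Fin (n + 1)) (f : ℕ → G.obj n) (a b : ℕ) :
    G.map θ (dProd f a b) = dProd (fun j => G.map θ (f j)) a b :=
  map_dProd (G.mapHom θ) f a b

theorem map_congr {m n : ℕ} {α β : Fin (m + 1) →o Fin (n + 1)} (h : ∀ v ≤ m, fApp α v = fApp β v)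
    (x : G.obj n) : G.map α x = G.map β x := by
  rw [orderHom_ext_fApp h]

theorem map_map_congr {m n k l : ℕ} {α : Fin (m + 1) →o Fin (k + 1)}
    {β : Fin (k + 1) →o Fin (n + 1)} {α' : Fin (m + 1) →o Fin (l + 1)}
    {β' : Fin (l + 1) →o Fin (n + 1)}
    (h : ∀ v ≤ m, fApp β (fApp α v) = fApp β' (fApp α' v)) (x : G.obj n) :
    G.map α (G.map β x) = G.map α' (G.map β' x) := by
  rw [G.map_comp, G.map_comp]
  exact G.map_congr (fun v hv => by rw [fApp_comp, fApp_comp, h v hv]) x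

theorem map_map_eq {m n k : ℕ} {α : Fin (m + 1) →o Fin (k + 1)}
    {β : Fin (k + 1) →o Fin (n + 1)} {ε : Fin (m + 1) →o Fin (n + 1)}
    (h : ∀ v ≤ m, fApp β (fApp α v) = fApp ε v) (x : G.obj n) :
    G.map α (G.map β x) = G.map ε x := by
  rw [G.map_comp]
  exact G.map_congr (fun v hv => by rw [fApp_comp, h v hv]) x

theorem map_map_eq_self {m n : ℕ} {α : Fin (n + 1) →o Fin (m + 1)}
    {β : Fin (m + 1) →o Fin (n + 1)}
    (h : ∀ v ≤ n, fApp β (fApp α v) = v) (x : G.obj n) :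
    G.map α (G.map β x) = x := by
  rw [G.map_map_eq (ε := OrderHom.id) (fun v hv => by rw [h v hv, fApp_id hv]), G.map_id]

/-- degeneracy `s_k : G_{N-1} → G_N` -/
def degen (k : ℕ) {N : ℕ} : G.obj (N - 1) → G.obj N := G.map (σOH k N (N - 1))

variable {G} {n : ℕ}

theorem face_mul (k : ℕ) (x y : G.obj n) : G.face k (x * y) = G.face k x * G.face k y :=
  G.map_mul _ x y

theorem face_inv (k : ℕ) (x : G.obj n) : G.face k x⁻¹ = (G.face k x)⁻¹ := G.map_inv' _ x

theorem degen_mul (k : ℕ) (x y : G.obj (n - 1)) :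
    G.degen k (x * y) = G.degen k x * G.degen k y :=
  G.map_mul _ x y

theorem degen_inv (k : ℕ) (x : G.obj (n - 1)) : G.degen k x⁻¹ = (G.degen k x)⁻¹ := G.map_inv' _ x

theorem degen_one (k : ℕ) : G.degen k (1 : G.obj (n - 1)) = 1 := G.map_one' _

theorem face_face {i j : ℕ} (hij : i < j) (hj : j ≤ n) (hn : 2 ≤ n) (x : G.obj n) :
    G.face i (G.face j x) = G.face (j - 1) (G.face i x) := by
  refine G.map_map_congr (fun v hv => ?_) x
  have h1 := fApp_le (δOH i (n - 1 - 1) (n - 1)) v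
  have h2 := fApp_le (δOH (j - 1) (n - 1 - 1) (n - 1)) v
  rw [fApp_δOH h1, fApp_δOH h2, fApp_δOH hv, fApp_δOH hv]
  split_ifs <;> omega

theorem face_degen_self {k : ℕ} (hk : k < n) (z : G.obj (n - 1)) :
    G.face k (G.degen k z) = z := by
  refine G.map_map_eq_self (fun v hv => ?_) z
  rw [fApp_σOH (fApp_le _ _), fApp_δOH hv]
  split_ifs <;> omega

theorem face_succ_degen {k : ℕ} (hk : k < n) (z : G.obj (n - 1)) :
    G.face (k + 1) (G.degen k z) = z := by
  refine G.map_map_eq_self (fun v hv => ?_) z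
  rw [fApp_σOH (fApp_le _ _), fApp_δOH hv]
  split_ifs <;> omega

theorem face_degen_of_lt {i k : ℕ} (hik : i < k) (hk : k < n) (z : G.obj (n - 1)) :
    G.face i (G.degen k z) = G.degen (k - 1) (G.face i z) := by
  refine G.map_map_congr (fun v hv => ?_) z
  rw [fApp_σOH (fApp_le _ _), fApp_δOH hv, fApp_δOH (fApp_le _ _), fApp_σOH hv]
  split_ifs <;> omega

theorem face_degen_of_gt {j k : ℕ} (hjk : k + 1 < j) (hj : j ≤ n) (z : G.obj (n - 1)) :
    G.face j (G.degen k z) = G.degen k (G.face (j - 1) z) := by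
  refine G.map_map_congr (fun v hv => ?_) z
  rw [fApp_σOH (fApp_le _ _), fApp_δOH hv, fApp_δOH (fApp_le _ _), fApp_σOH hv]
  split_ifs <;> omega

/-- Successively correct `x` so that its faces `0, …, k - 1` become `y 0, …, y (k - 1)`. -/
def correct (y : ℕ → G.obj (n - 1)) (x : G.obj n) : ℕ → G.obj n
  | 0 => x
  | k + 1 => correct y x k * G.degen k ((G.face k (correct y x k))⁻¹ * y k)

theorem correct_succ (y : ℕ → G.obj (n - 1)) (x : G.obj n) (k : ℕ) :
    correct y x (k + 1) =
      correct y x k * G.degen k ((G.face k (correct y x k))⁻¹ * y k) := rfl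

theorem correct_congr {y y' : ℕ → G.obj (n - 1)} (x : G.obj n) {k : ℕ}
    (h : ∀ i < k, y i = y' i) : correct y x k = correct y' x k := by
  induction k with
  | zero => rfl
  | succ k ih =>
    rw [correct_succ, correct_succ, ih fun i hi => h i (by omega), h k (by omega)]

theorem correct_mul (a : G.obj n) (y : ℕ → G.obj (n - 1)) (x : G.obj n) (k : ℕ) :
    correct (fun i => G.face i a * y i) (a * x) k = a * correct y x k := by
  induction k with
  | zero => rfl
  | succ k ih =>
    rw [correct_succ, correct_succ, ih, face_mul]
    group

/-- The corrected simplex has the prescribed faces. -/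
theorem face_correct_of_lt {y : ℕ → G.obj (n - 1)} (x : G.obj n) {k : ℕ} (hk : k ≤ n)
    (hy : ∀ i j, i < j → j < k → G.face i (y j) = G.face (j - 1) (y i)) {i : ℕ} (hi : i < k) :
    G.face i (correct y x k) = y i := by
  induction k with
  | zero => omega
  | succ k ih =>
    rw [correct_succ, face_mul]
    rcases Nat.lt_succ_iff_lt_or_eq.mp hi with h | rfl
    · have IH := ih (by omega) (fun a b hab hb => hy a b hab (by omega)) h
      rw [face_degen_of_lt h (by omega), face_mul, face_inv, face_face h (by omega) (by omega),
        IH, hy i k h (by omega), inv_mul_cancel, degen_one, mul_one]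
    · rw [face_degen_self (by omega), mul_inv_cancel_left]

/-- The faces of the corrected simplex not yet treated. -/
theorem face_correct_of_gt (y : ℕ → G.obj (n - 1)) (x : G.obj n) {j k : ℕ} (hkj : k < j)
    (hj : j ≤ n) :
    G.face j (correct y x k) = correct (fun i => G.face (j - 1) (y i)) (G.face j x) k := by
  induction k with
  | zero => rfl
  | succ k ih =>
    rw [correct_succ, face_mul, face_degen_of_gt hkj hj, correct_succ, ← ih (by omega), face_mul,
      face_inv, face_face (show k < j by omega) hj (by omega)]

theorem correct_injective {y : ℕ → G.obj (n - 1)} {x x' : G.obj n}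
    (hx : ∀ j, 1 ≤ j → j ≤ n → G.face j x = G.face j x') {k : ℕ} (hk : k ≤ n)
    (h : correct y x k = correct y x' k) : x = x' := by
  induction k with
  | zero => exact h
  | succ k ih =>
    refine ih (by omega) ?_
    have hf : G.face (k + 1) (correct y x k) = G.face (k + 1) (correct y x' k) := by
      rw [face_correct_of_gt y x (Nat.lt_succ_self k) hk,
        face_correct_of_gt y x' (Nat.lt_succ_self k) hk, hx (k + 1) (by omega) hk]
    have h' := congrArg (G.face (k + 1)) h
    rw [correct_succ, correct_succ, face_mul, face_mul, hf, face_succ_degen (by omega),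
      face_succ_degen (by omega)] at h'
    have h'' := mul_left_cancel h'
    rw [correct_succ, correct_succ, h''] at h
    exact mul_right_cancel h

/-- Existence of a simplex with prescribed faces `1, …, n` and prescribed correction. -/
theorem exists_correct_eq {y r : ℕ → G.obj (n - 1)}
    (hy : ∀ i j, i < j → j < n → G.face i (y j) = G.face (j - 1) (y i))
    (hr : ∀ i j, 1 ≤ i → i < j → j ≤ n → G.face i (r j) = G.face (j - 1) (r i)) {k : ℕ}
    (hk : k ≤ n) (t : G.obj n) (hlt : ∀ i < k, G.face i t = y i)
    (hgt : ∀ j, k < j → j ≤ n →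
      G.face j t = correct (fun i => G.face (j - 1) (y i)) (r j) k) :
    ∃ x, (∀ j, 1 ≤ j → j ≤ n → G.face j x = r j) ∧ correct y x k = t := by
  induction k generalizing t with
  | zero => exact ⟨t, fun j h1 h2 => hgt j h1 h2, rfl⟩
  | succ k ih =>
    set u : ℕ → G.obj (n - 1) := fun j => correct (fun i => G.face (j - 1) (y i)) (r j) k with hu
    have hu_lt : ∀ i j, i < k → k < j → j ≤ n → G.face i (u j) = G.face (j - 1) (y i) := by
      intro i j hi hj hjn
      refine face_correct_of_lt (y := fun i => G.face (j - 1) (y i)) (r j) (by omega) ?_ hi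
      intro a b hab hb
      rw [face_face (show a < j - 1 by omega) (by omega) (by omega), hy a b hab (by omega),
        face_face (show b - 1 < j - 1 by omega) (by omega) (by omega)]
    have hu_gt : ∀ a b, k < a → a < b → b ≤ n → G.face a (u b) = G.face (b - 1) (u a) := by
      intro a b ha hab hb
      rw [hu]
      simp only
      rw [face_correct_of_gt _ _ ha (by omega), face_correct_of_gt _ _ (by omega) (by omega),
        hr a b (by omega) hab hb]
      refine correct_congr _ fun i hi => ?_
      rw [face_face (show a - 1 < b - 1 by omega) (by omega) (by omega)]
    have hu_succ : ∀ j, k + 1 < j → j ≤ n →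
        G.face j t = u j * G.degen k ((G.face k (u j))⁻¹ * G.face (j - 1) (y k)) :=
      fun j h1 h2 => hgt j h1 h2
    set x := t * G.degen k ((G.face (k + 1) t)⁻¹ * u (k + 1)) with hx
    have hx_face : ∀ j, k < j → j ≤ n → G.face j x = u j := by
      intro j hj hjn
      rw [hx, face_mul]
      rcases Nat.lt_or_eq_of_le (Nat.succ_le_of_lt hj) with h | rfl
      · have h : k + 1 < j := h
        rw [face_degen_of_gt h hjn, face_mul, face_inv,
          ← hu_gt (k + 1) j (by omega) h hjn,
          ← face_face h hjn (by omega), hu_succ j h hjn, face_mul,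
          face_succ_degen (by omega)]
        rw [mul_assoc, ← degen_mul]
        have : (G.face k (u j))⁻¹ * G.face (j - 1) (y k) *
            ((G.face (k + 1) (u j) * ((G.face k (u j))⁻¹ * G.face (j - 1) (y k)))⁻¹ *
              G.face (k + 1) (u j)) = 1 := by group
        rw [this, degen_one, mul_one]
      · rw [Nat.succ_eq_add_one, face_succ_degen (by omega), mul_inv_cancel_left]
    have hx_lt : ∀ i < k, G.face i x = y i := by
      intro i hi
      rw [hx, face_mul, face_degen_of_lt hi (by omega), face_mul, face_inv,
        face_face (show i < k + 1 by omega) hk (by omega), hlt i (by omega),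
        hu_lt i (k + 1) hi (by omega) hk, inv_mul_cancel, degen_one, mul_one]
    obtain ⟨x₀, h1, h2⟩ := ih (by omega) x hx_lt hx_face
    refine ⟨x₀, h1, ?_⟩
    have hxk : G.face k x = y k * ((G.face (k + 1) t)⁻¹ * u (k + 1)) := by
      rw [hx, face_mul, face_degen_self (by omega), hlt k (by omega)]
    rw [correct_succ, h2, hxk, hx, mul_assoc, ← degen_mul]
    have : (G.face (k + 1) t)⁻¹ * u (k + 1) *
        ((y k * ((G.face (k + 1) t)⁻¹ * u (k + 1)))⁻¹ * y k) = 1 := by group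
    rw [this, degen_one, mul_one]

end SGrp

end Paper

namespace Paper

namespace SGrp

variable {G : SGrp}

/-- Pull back a family of `n`-simplices, indexed by the vertices of `[n]`, along `θ`. -/
def pull {m n : ℕ} (θ : Fin (m + 1) →o Fin (n + 1)) (s : ℕ → G.obj n) : ℕ → G.obj m :=
  fun v => G.map θ (s (fApp θ v))

theorem pull_pull {l m n : ℕ} (α : Fin (l + 1) →o Fin (m + 1)) (β : Fin (m + 1) →o Fin (n + 1))
    (s : ℕ → G.obj n) : pull α (pull β s) = pull (β.comp α) s := by
  funext v
  simp only [pull]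
  rw [G.map_comp, fApp_comp]

theorem pull_pull_congr {m n k l : ℕ} {α : Fin (m + 1) →o Fin (k + 1)}
    {β : Fin (k + 1) →o Fin (n + 1)} {α' : Fin (m + 1) →o Fin (l + 1)}
    {β' : Fin (l + 1) →o Fin (n + 1)}
    (h : ∀ v ≤ m, fApp β (fApp α v) = fApp β' (fApp α' v)) (s : ℕ → G.obj n) :
    pull α (pull β s) = pull α' (pull β' s) := by
  rw [pull_pull, pull_pull, orderHom_ext_fApp (α := β.comp α) (β := β'.comp α')]
  intro v hv
  rw [fApp_comp, fApp_comp, h v hv]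

/-- Two families of simplices agree if, for each vertex `v`, their `v`-th members agree on the
final segment starting at `v`. -/
def Agree {n : ℕ} (s s' : ℕ → G.obj n) : Prop :=
  ∀ (v l : ℕ) (φ : Fin (l + 1) →o Fin (n + 1)), (∀ w ≤ l, v ≤ fApp φ w) →
    G.map φ (s v) = G.map φ (s' v)

theorem Agree.symm {n : ℕ} {s s' : ℕ → G.obj n} (h : Agree s s') : Agree s' s :=
  fun v l φ hφ => (h v l φ hφ).symm

theorem Agree.zero {n : ℕ} {s s' : ℕ → G.obj n} (h : Agree s s') : s 0 = s' 0 := by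
  have := h 0 n OrderHom.id (fun _ _ => Nat.zero_le _)
  rwa [G.map_id, G.map_id] at this

theorem Agree.pull {m n : ℕ} {s s' : ℕ → G.obj n} (h : Agree s s')
    (θ : Fin (m + 1) →o Fin (n + 1)) : Agree (pull θ s) (pull θ s') := by
  intro v l φ hφ
  simp only [SGrp.pull]
  rw [G.map_comp, G.map_comp]
  refine h _ l _ fun w hw => ?_
  rw [fApp_comp]
  exact fApp_mono θ (hφ w hw)

theorem agree_of_pull {n : ℕ} {s s' : ℕ → G.obj (n + 1)} (h0 : s 0 = s' 0)
    (h : Agree (pull (δOH 0 n (n + 1)) s) (pull (δOH 0 n (n + 1)) s')) : Agree s s' := by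
  intro v l φ hφ
  cases v with
  | zero => rw [h0]
  | succ v =>
    have hvn : v ≤ n := by
      have h1 := hφ 0 (Nat.zero_le _)
      have h2 := fApp_le φ 0
      omega
    have key := h v l ((σOH 0 (n + 1) n).comp φ) (fun w hw => by
      have h1 := hφ w hw
      have h2 := fApp_le φ w
      rw [fApp_comp, fApp_σOH h2]
      split_ifs <;> omega)
    have hv : fApp (δOH 0 n (n + 1)) v = v + 1 := by
      rw [fApp_δOH hvn]
      simp
      omega
    simp only [SGrp.pull, hv] at key
    have hφ' : ∀ w ≤ l, fApp (δOH 0 n (n + 1)) (fApp ((σOH 0 (n + 1) n).comp φ) w) =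
        fApp φ w := by
      intro w hw
      have h1 := hφ w hw
      have h2 := fApp_le φ w
      rw [fApp_δOH (fApp_le _ _), fApp_comp, fApp_σOH h2]
      split_ifs <;> omega
    rwa [G.map_map_eq hφ', G.map_map_eq hφ'] at key

theorem agree_of_zero {s s' : ℕ → G.obj 0} (h0 : s 0 = s' 0) : Agree s s' := by
  intro v l φ hφ
  have h1 := hφ 0 (Nat.zero_le _)
  have h2 := fApp_le φ 0
  obtain rfl : v = 0 := by omega
  rw [h0]

/-- Glue a family `s`, where `s v` is regarded as a simplex over the final segment starting
at `v`, to a single simplex natural in vertex-maps preserving the last vertex. -/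
def glue : (n : ℕ) → (ℕ → G.obj n) → G.obj n
  | 0, s => s 0
  | n + 1, s =>
    correct (n := n + 1) (fun k => glue n (pull (δOH k n (n + 1)) s)) (s 0) (n + 1)

theorem glue_succ {n : ℕ} (s : ℕ → G.obj (n + 1)) :
    glue (n + 1) s =
      correct (n := n + 1) (fun k => glue n (pull (δOH k n (n + 1)) s)) (s 0) (n + 1) := rfl

theorem Agree.glue_eq {n : ℕ} {s s' : ℕ → G.obj n} (h : Agree s s') : glue n s = glue n s' := by
  induction n with
  | zero => exact h.zero
  | succ n ih =>
    rw [glue_succ, glue_succ, h.zero]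
    exact correct_congr _ fun k _ => ih (h.pull _)

theorem pull_mul {m n : ℕ} (θ : Fin (m + 1) →o Fin (n + 1)) (a : G.obj n) (s : ℕ → G.obj n) :
    pull θ (fun v => a * s v) = fun v => G.map θ a * pull θ s v := by
  funext v
  exact G.map_mul θ _ _

theorem glue_mul {n : ℕ} (a : G.obj n) (s : ℕ → G.obj n) :
    glue n (fun v => a * s v) = a * glue n s := by
  induction n with
  | zero => rfl
  | succ n ih =>
    rw [glue_succ, glue_succ, ← correct_mul]
    refine correct_congr _ fun k _ => ?_
    rw [pull_mul, ih]
    rfl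

theorem pull_δOH_δOH {n i j : ℕ} (hij : i < j) (hj : j ≤ n + 2) (s : ℕ → G.obj (n + 2)) :
    pull (δOH i n (n + 1)) (pull (δOH j (n + 1) (n + 2)) s) =
      pull (δOH (j - 1) n (n + 1)) (pull (δOH i (n + 1) (n + 2)) s) := by
  refine pull_pull_congr (fun v hv => ?_) s
  rw [fApp_δOH (fApp_le _ _), fApp_δOH (fApp_le _ _), fApp_δOH hv, fApp_δOH hv]
  split_ifs <;> omega

theorem face_glue {n k : ℕ} (hk : k ≤ n) (s : ℕ → G.obj (n + 1)) :
    G.face k (glue (n + 1) s) = glue n (pull (δOH k n (n + 1)) s) := by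
  induction n generalizing k with
  | zero =>
    rw [glue_succ]
    exact face_correct_of_lt (n := 1) (k := 1) (s 0) le_rfl (fun i j hij hj => by omega)
      (by omega)
  | succ n ih =>
    rw [glue_succ]
    refine face_correct_of_lt (n := n + 1 + 1)
      (y := fun k => glue (n + 1) (pull (δOH k (n + 1) (n + 1 + 1)) s)) (s 0) le_rfl
      (fun i j hij hj => ?_) (by omega)
    refine (ih (by omega) _).trans (Eq.trans ?_ (ih (by omega) _).symm)
    rw [pull_δOH_δOH hij (by omega)]

theorem pull_δOH_σOH_self {n k : ℕ} {i : ℕ} (hi : i ≤ n) (hk : k = i ∨ k = i + 1)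
    (s : ℕ → G.obj n) {v : ℕ} (hv : v ≤ n) :
    pull (δOH k n (n + 1)) (pull (σOH i (n + 1) n) s) v = s v := by
  have h : ∀ w ≤ n, fApp (σOH i (n + 1) n) (fApp (δOH k n (n + 1)) w) = w := by
    intro w hw
    rw [fApp_σOH (fApp_le _ _), fApp_δOH hw]
    split_ifs <;> omega
  simp only [pull]
  rw [G.map_map_eq_self h, h v hv]

theorem agree_of_eq {n : ℕ} {s s' : ℕ → G.obj n} (h : ∀ v ≤ n, s v = s' v) : Agree s s' := by
  intro v l φ hφ
  have h1 := hφ 0 (Nat.zero_le _)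
  have h2 := fApp_le φ 0
  rw [h v (by omega)]

theorem pull_δOH_σOH_of_lt {n k i : ℕ} (hi : i ≤ n + 1) (hk : k < i) (s : ℕ → G.obj (n + 1)) :
    pull (δOH k (n + 1) (n + 2)) (pull (σOH i (n + 2) (n + 1)) s) =
      pull (σOH (i - 1) (n + 1) n) (pull (δOH k n (n + 1)) s) := by
  refine pull_pull_congr (fun v hv => ?_) s
  rw [fApp_δOH (fApp_le _ _), fApp_σOH (fApp_le _ _), fApp_δOH hv, fApp_σOH hv]
  split_ifs <;> omega

theorem pull_δOH_σOH_of_gt {n k i : ℕ} (hi : i + 1 < k) (hk : k ≤ n + 2)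
    (s : ℕ → G.obj (n + 1)) :
    pull (δOH k (n + 1) (n + 2)) (pull (σOH i (n + 2) (n + 1)) s) =
      pull (σOH i (n + 1) n) (pull (δOH (k - 1) n (n + 1)) s) := by
  refine pull_pull_congr (fun v hv => ?_) s
  rw [fApp_δOH (fApp_le _ _), fApp_σOH (fApp_le _ _), fApp_δOH hv, fApp_σOH hv]
  split_ifs <;> omega

theorem pull_σOH_zero {n i : ℕ} (s : ℕ → G.obj n) :
    pull (σOH i (n + 1) n) s 0 = G.degen (N := n + 1) i (s 0) := by
  simp only [pull]
  rw [fApp_σOH (Nat.zero_le _)]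
  simp [degen]

theorem degen_degen {n i k : ℕ} (hk : k < i) (hi : i ≤ n + 1) (z : G.obj n) :
    G.degen (N := n + 2) k (G.degen (N := n + 1) (i - 1) z) =
      G.degen (N := n + 2) i (G.degen (N := n + 1) k z) := by
  refine G.map_map_congr (fun v hv => ?_) z
  change fApp (σOH (i - 1) (n + 1) n) (fApp (σOH k (n + 2) (n + 1)) v) =
    fApp (σOH k (n + 1) n) (fApp (σOH i (n + 2) (n + 1)) v)
  rw [fApp_σOH (fApp_le _ _), fApp_σOH (fApp_le _ _), fApp_σOH hv, fApp_σOH hv]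
  split_ifs <;> omega

theorem degen_glue {n i : ℕ} (hi : i ≤ n) (s : ℕ → G.obj n) :
    G.degen (N := n + 1) i (glue n s) = glue (n + 1) (pull (σOH i (n + 1) n) s) := by
  induction n generalizing i with
  | zero =>
    obtain rfl : i = 0 := by omega
    rw [glue_succ, pull_σOH_zero, correct_succ]
    simp only [correct]
    rw [face_degen_self (n := 0 + 1) (by omega)]
    have h : glue 0 (pull (δOH 0 0 (0 + 1)) (pull (σOH 0 (0 + 1) 0) s)) = s 0 :=
      pull_δOH_σOH_self le_rfl (Or.inl rfl) s le_rfl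
    rw [h, glue]
    erw [inv_mul_cancel, degen_one, mul_one]
  | succ n ih =>
    set y : ℕ → G.obj (n + 1) := fun k =>
      glue (n + 1) (pull (δOH k (n + 1) (n + 2)) (pull (σOH i (n + 2) (n + 1)) s)) with hy
    set z : ℕ → G.obj n := fun k => glue n (pull (δOH k n (n + 1)) s) with hz
    have y_lt : ∀ k < i, y k = G.degen (N := n + 1) (i - 1) (z k) := by
      intro k hk
      simp only [hy, hz]
      rw [pull_δOH_σOH_of_lt hi hk, ih (by omega)]
    have y_self : ∀ k, k = i ∨ k = i + 1 → y k = glue (n + 1) s := fun k hk =>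
      (agree_of_eq fun v hv => pull_δOH_σOH_self hi hk s hv).glue_eq
    have y_gt : ∀ k, i + 1 < k → k ≤ n + 1 → y k = G.degen (N := n + 1) i (z (k - 1)) := by
      intro k hk hkn
      simp only [hy, hz]
      rw [pull_δOH_σOH_of_gt hk (by omega), ih (by omega)]
    have before : ∀ k ≤ i, correct (n := n + 2) y (G.degen (N := n + 2) i (s 0)) k =
        G.degen (N := n + 2) i (correct (n := n + 1) z (s 0) k) := by
      intro k hk
      induction k with
      | zero => rfl
      | succ k ihk =>
        rw [correct_succ, ihk (by omega), y_lt k (by omega), correct_succ,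
          face_degen_of_lt (n := n + 2) (by omega) (by omega)]
        refine Eq.trans (congrArg _ (Eq.trans (congrArg _ ?_) (degen_degen (by omega) hi _)))
          (degen_mul (n := n + 2) i _ _).symm
        exact (congrArg (· * _) (degen_inv (n := n + 1) (i - 1) _).symm).trans
          (degen_mul (n := n + 1) (i - 1) _ _).symm
    have after : ∀ k, i + 1 ≤ k → k ≤ n + 2 →
        correct (n := n + 2) y (G.degen (N := n + 2) i (s 0)) k =
          G.degen (N := n + 2) i (glue (n + 1) s) := by
      intro k hk
      induction k, hk using Nat.le_induction with
      | base =>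
        intro _
        rw [correct_succ, before i le_rfl, y_self i (Or.inl rfl),
          face_degen_self (n := n + 2) (by omega)]
        refine (degen_mul (n := n + 2) i _ _).symm.trans ?_
        exact congrArg _ (mul_inv_cancel_left _ _)
      | succ k hk ihk =>
        intro hkn
        rw [correct_succ, ihk (by omega)]
        have hface : G.face k (G.degen (N := n + 2) i (glue (n + 1) s)) = y k := by
          rcases Nat.lt_or_eq_of_le hk with h | rfl
          · rw [face_degen_of_gt (n := n + 2) h (by omega), y_gt k h (by omega)]
            exact congrArg _ (face_glue (by omega) s)
          · rw [face_succ_degen (n := n + 2) (by omega), y_self _ (Or.inr rfl)]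
        rw [hface]
        erw [inv_mul_cancel, degen_one, mul_one]
    rw [glue_succ (pull _ s), pull_σOH_zero]
    exact (after (n + 2) (by omega) le_rfl).symm

theorem map_glue {m n : ℕ} (θ : Fin (m + 1) →o Fin (n + 1)) (hθ : fApp θ m = n)
    (s : ℕ → G.obj n) : G.map θ (glue n s) = glue m (pull θ s) := by
  obtain ⟨N, hN⟩ : ∃ N, m + n = N := ⟨_, rfl⟩
  induction N using Nat.strong_induction_on generalizing m n with
  | _ N ih =>
  by_cases hdeg : ∃ i < m, fApp θ i = fApp θ (i + 1)
  · obtain ⟨i, him, hi⟩ := hdeg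
    obtain ⟨m, rfl⟩ : ∃ m', m = m' + 1 := ⟨m - 1, by omega⟩
    have hfac : θ = (θ.comp (δOH i m (m + 1))).comp (σOH i (m + 1) m) := by
      refine orderHom_ext_fApp fun v hv => ?_
      rw [fApp_comp, fApp_comp, fApp_δOH (fApp_le _ _), fApp_σOH hv]
      by_cases h : v = i
      · subst h
        rw [hi]
        congr 1
        split_ifs <;> omega
      · congr 1
        split_ifs <;> omega
    have htop : fApp (θ.comp (δOH i m (m + 1))) m = n := by
      rw [fApp_comp, fApp_δOH le_rfl]
      refine Eq.trans (congrArg _ ?_) hθ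
      split_ifs <;> omega
    rw [hfac, ← G.map_comp, ← pull_pull, ih (m + n) (by omega) _ htop s rfl]
    exact degen_glue (by omega) _
  · have hlt : ∀ i < m, fApp θ i < fApp θ (i + 1) := fun i hi =>
      lt_of_le_of_ne (fApp_mono θ (Nat.le_succ i)) fun h => hdeg ⟨i, hi, h⟩
    by_cases hmiss : ∃ k ≤ n, ∀ v ≤ m, fApp θ v ≠ k
    · obtain ⟨k, hkn, hk⟩ := hmiss
      have hkn' : k ≠ n := fun h => hk m le_rfl (hθ.trans h.symm)
      obtain ⟨n, rfl⟩ : ∃ n', n = n' + 1 := ⟨n - 1, by omega⟩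
      have hfac : θ = (δOH k n (n + 1)).comp ((σOH k (n + 1) n).comp θ) := by
        refine orderHom_ext_fApp fun v hv => ?_
        have h1 := fApp_le θ v
        have h2 := hk v hv
        rw [fApp_comp, fApp_comp, fApp_δOH (fApp_le _ _), fApp_σOH h1]
        split_ifs <;> omega
      have htop : fApp ((σOH k (n + 1) n).comp θ) m = n := by
        rw [fApp_comp, hθ, fApp_σOH le_rfl]
        split_ifs <;> omega
      rw [hfac, ← G.map_comp, ← pull_pull, ← ih (m + n) (by omega) _ htop _ rfl]
      exact congrArg _ (face_glue (by omega) s)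
    · have hsurj : ∀ k ≤ n, ∃ v ≤ m, fApp θ v = k := by
        intro k hk
        by_contra h
        exact hmiss ⟨k, hk, fun v hv hv' => h ⟨v, hv, hv'⟩⟩
      have hge : ∀ i ≤ m, i ≤ fApp θ i := by
        intro i hi
        induction i with
        | zero => exact Nat.zero_le _
        | succ i ihi =>
          have := hlt i (by omega)
          have := ihi (by omega)
          omega
      have hinc : ∀ i j, i < j → j ≤ m → fApp θ i < fApp θ j := by
        intro i j hij hj
        exact lt_of_lt_of_le (hlt i (by omega)) (fApp_mono θ hij)
      have hle : ∀ i ≤ m, fApp θ i ≤ i := by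
        intro i
        induction i with
        | zero =>
          intro _
          obtain ⟨v, hv, h0⟩ := hsurj 0 (Nat.zero_le _)
          have := fApp_mono θ (Nat.zero_le v)
          omega
        | succ i ihi =>
          intro hi
          have h1 := ihi (by omega)
          by_contra hcon
          obtain ⟨v, hv, h0⟩ := hsurj (i + 1) (by have := fApp_le θ (i + 1); omega)
          rcases Nat.lt_or_ge i v with h | h
          · have := fApp_mono θ (show i + 1 ≤ v from h)
            omega
          · have := fApp_mono θ h
            omega
      obtain rfl : m = n := le_antisymm (hθ ▸ hge m le_rfl) (hθ ▸ hle m le_rfl)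
      obtain rfl : θ = OrderHom.id := orderHom_ext_fApp fun v hv => by
        rw [fApp_id hv]
        exact le_antisymm (hle v hv) (hge v hv)
      rw [G.map_id]
      refine (agree_of_eq fun v hv => ?_).glue_eq
      simp only [pull]
      rw [G.map_id, fApp_id hv]

theorem Agree.trans {n : ℕ} {s s' s'' : ℕ → G.obj n} (h : Agree s s') (h' : Agree s' s'') :
    Agree s s'' :=
  fun v l φ hφ => (h v l φ hφ).trans (h' v l φ hφ)

theorem map_congr_index (t : ∀ v, G.obj v) {m a b : ℕ} (hab : a = b)
    {α : Fin (m + 1) →o Fin (a + 1)} {β : Fin (m + 1) →o Fin (b + 1)}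
    (h : ∀ w ≤ m, fApp α w = fApp β w) : G.map α (t a) = G.map β (t b) := by
  subst hab
  exact G.map_congr h _

theorem map_eq_of_index (t : ∀ v, G.obj v) {a b : ℕ} (hab : a = b)
    {α : Fin (b + 1) →o Fin (a + 1)} (h : ∀ w ≤ b, fApp α w = w) : G.map α (t a) = t b := by
  rw [map_congr_index t hab (β := OrderHom.id) fun w hw => by rw [h w hw, fApp_id hw], G.map_id]

/-- The simplex glued from the restriction of a family to the initial segment `[v]`. -/
def glueAt {n : ℕ} (v : ℕ) (s : ℕ → G.obj n) : G.obj v := glue v (pull (initial v n) s)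

theorem Agree.glueAt_eq {n : ℕ} {s s' : ℕ → G.obj n} (h : Agree s s') (v : ℕ) :
    glueAt v s = glueAt v s' :=
  (h.pull _).glue_eq

theorem glueAt_mul {n : ℕ} (v : ℕ) (a : G.obj n) (s : ℕ → G.obj n) :
    glueAt v (fun w => a * s w) = G.map (initial v n) a * glueAt v s := by
  rw [glueAt, pull_mul, glue_mul]
  rfl

theorem glueAt_self {n : ℕ} (s : ℕ → G.obj n) : glueAt n s = glue n s := by
  refine (agree_of_eq fun v hv => ?_).glue_eq
  simp only [pull]
  rw [fApp_initial hv, min_eq_left hv,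
    G.map_congr (β := OrderHom.id) fun w hw => by rw [fApp_initial hw, fApp_id hw, min_eq_left hw],
    G.map_id]

theorem glueAt_pull {m n v : ℕ} (hv : v ≤ m) (θ : Fin (m + 1) →o Fin (n + 1)) (s : ℕ → G.obj n) :
    glueAt v (pull θ s) = G.map (restrictOH θ v (fApp θ v)) (glueAt (fApp θ v) s) := by
  rw [glueAt, glueAt, map_glue _ (by rw [fApp_restrictOH θ le_rfl, min_self])]
  congr 1
  refine pull_pull_congr (fun w hw => ?_) s
  have h1 := fApp_mono θ hw
  have h2 := fApp_le θ w
  rw [fApp_initial hw, fApp_initial (fApp_le _ _), fApp_restrictOH θ hw,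
    min_eq_left (hw.trans hv)]
  omega

theorem pull_δOH_zero {n j : ℕ} (hj : 1 ≤ j) (s : ℕ → G.obj (n + 1)) :
    pull (δOH j n (n + 1)) s 0 = G.face j (s 0) := by
  simp only [pull]
  rw [fApp_δOH (Nat.zero_le _), if_pos (by omega), min_eq_left (Nat.zero_le _)]
  rfl

theorem agree_of_glueAt {n : ℕ} {s s' : ℕ → G.obj n} (h : ∀ v ≤ n, glueAt v s = glueAt v s') :
    Agree s s' := by
  induction n with
  | zero =>
    have h0 := h 0 le_rfl
    rw [glueAt_self, glueAt_self] at h0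
    exact agree_of_zero h0
  | succ n ih =>
    have hface : ∀ k, Agree (pull (δOH k n (n + 1)) s) (pull (δOH k n (n + 1)) s') := by
      refine fun k => ih fun v hv => ?_
      rw [glueAt_pull hv, glueAt_pull hv, h _ (fApp_le _ _)]
    refine agree_of_pull ?_ (hface 0)
    have hn := h (n + 1) le_rfl
    rw [glueAt_self, glueAt_self, glue_succ, glue_succ,
      correct_congr (s 0) fun k _ => (hface k).glue_eq] at hn
    refine correct_injective (n := n + 1) (fun j hj _ => ?_) le_rfl hn
    have := (hface j).zero
    rwa [pull_δOH_zero hj, pull_δOH_zero hj] at this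

theorem agree_pull_δOH_of_glueAt {p : ℕ} (t : ∀ v, G.obj v) {S : ℕ → ℕ → G.obj (p + 1)}
    (hS : ∀ k, ∀ v ≤ p + 1, glueAt v (S k) =
      G.map (restrictOH (δOH k (p + 1) (p + 1 + 1)) v (fApp (δOH k (p + 1) (p + 1 + 1)) v)) (t _))
    {i j : ℕ} (hij : i < j) (hj : j ≤ p + 1 + 1) :
    Agree (pull (δOH i p (p + 1)) (S j)) (pull (δOH (j - 1) p (p + 1)) (S i)) := by
  refine agree_of_glueAt fun v hv => ?_
  rw [glueAt_pull hv, glueAt_pull hv, hS j _ (fApp_le _ _), hS i _ (fApp_le _ _),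
    G.map_comp, G.map_comp]
  refine map_congr_index t ?_ fun w hw => ?_
  · rw [fApp_δOH (fApp_le _ _), fApp_δOH (fApp_le _ _), fApp_δOH hv, fApp_δOH hv]
    split_ifs <;> omega
  · have hwp := hw.trans hv
    have h1 : ∀ k, fApp (δOH k p (p + 1)) w ≤ fApp (δOH k p (p + 1)) v :=
      fun k => fApp_mono _ hw
    have h2 : ∀ k l, fApp (δOH l (p + 1) (p + 1 + 1)) (fApp (δOH k p (p + 1)) w) ≤
        fApp (δOH l (p + 1) (p + 1 + 1)) (fApp (δOH k p (p + 1)) v) :=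
      fun k l => fApp_mono _ (h1 k)
    rw [fApp_comp, fApp_comp, fApp_restrictOH _ (fApp_le _ _), fApp_restrictOH _ hw,
      fApp_restrictOH _ (fApp_le _ _), fApp_restrictOH _ hw, min_eq_left (h1 _),
      min_eq_left (h1 _), min_eq_left (h2 _ _), min_eq_left (h2 _ _),
      fApp_δOH (fApp_le _ _), fApp_δOH (fApp_le _ _), fApp_δOH hwp, fApp_δOH hwp]
    split_ifs <;> omega

theorem exists_glueAt_eq (n : ℕ) (t : ∀ v, G.obj v) :
    ∃ s : ℕ → G.obj n, ∀ v ≤ n, glueAt v s = t v := by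
  induction n generalizing t with
  | zero =>
    refine ⟨fun _ => t 0, fun v hv => ?_⟩
    obtain rfl : v = 0 := by omega
    rw [glueAt_self]
    rfl
  | succ n ih =>
    choose S hS using fun k : ℕ =>
      ih fun v => G.map (restrictOH (δOH k n (n + 1)) v (fApp (δOH k n (n + 1)) v)) (t _)
    obtain ⟨x, hxr, hxt⟩ := exists_correct_eq (n := n + 1)
      (y := fun k => G.face k (t (n + 1))) (r := fun j => S j 0)
      (fun i j hij hj => face_face hij (by omega) (by omega) _)
      (fun i j hi hij hj => by
        obtain ⟨p, rfl⟩ : ∃ p, n = p + 1 := ⟨n - 1, by omega⟩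
        have := (agree_pull_δOH_of_glueAt t hS hij hj).zero
        rwa [pull_δOH_zero hi, pull_δOH_zero (by omega)] at this)
      le_rfl (t (n + 1)) (fun _ _ => rfl) (fun j h1 h2 => by omega)
    set s : ℕ → G.obj (n + 1) :=
      fun v => if v = 0 then x else G.degen (N := n + 1) 0 (S 0 (v - 1)) with hs
    have hs0 : s 0 = x := rfl
    have agree_zero : Agree (pull (δOH 0 n (n + 1)) s) (S 0) := by
      refine agree_of_eq fun v hv => ?_
      have hv' : fApp (δOH 0 n (n + 1)) v = v + 1 := by
        rw [fApp_δOH hv]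
        simp
        omega
      simp only [pull]
      rw [hv']
      exact face_degen_self (n := n + 1) (by omega) _
    have agree : ∀ k ≤ n + 1, Agree (pull (δOH k n (n + 1)) s) (S k) := by
      intro k hk
      rcases Nat.eq_zero_or_pos k with rfl | hpos
      · exact agree_zero
      have h0 : pull (δOH k n (n + 1)) s 0 = S k 0 := by
        rw [pull_δOH_zero hpos, hs0]
        exact hxr k hpos hk
      cases n with
      | zero => exact agree_of_zero h0
      | succ p =>
        refine agree_of_pull h0 ?_
        rw [pull_δOH_δOH hpos hk]
        exact (agree_zero.pull _).trans (agree_pull_δOH_of_glueAt t hS hpos hk).symm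
    refine ⟨s, fun v hv => ?_⟩
    rcases Nat.lt_or_eq_of_le hv with h | rfl
    · have hpull : pull (initial v (n + 1)) s =
          pull (initial v n) (pull (δOH (n + 1) n (n + 1)) s) := by
        rw [pull_pull]
        congr 1
        refine orderHom_ext_fApp fun w hw => ?_
        rw [fApp_comp, fApp_initial hw, fApp_initial hw, fApp_δOH (by omega)]
        split_ifs <;> omega
      rw [glueAt, hpull]
      refine ((agree (n + 1) le_rfl).glueAt_eq v).trans ((hS (n + 1) v (by omega)).trans ?_)
      have hδ : ∀ w ≤ v, fApp (δOH (n + 1) n (n + 1)) w = w := by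
        intro w hw
        rw [fApp_δOH (by omega)]
        split_ifs <;> omega
      refine map_eq_of_index t (hδ v le_rfl) fun w hw => ?_
      rw [fApp_restrictOH _ hw, hδ w hw, hδ v le_rfl, min_eq_left hw]
    · rw [glueAt_self, glue_succ, ← hxt]
      refine correct_congr _ fun k hk => ?_
      have hkn : fApp (δOH k n (n + 1)) n = n + 1 := by
        rw [fApp_δOH le_rfl]
        split_ifs <;> omega
      rw [(agree k (by omega)).glue_eq, ← glueAt_self, hS k n le_rfl]
      refine map_congr_index t hkn fun w hw => ?_
      rw [fApp_restrictOH _ hw, hkn]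
      exact min_eq_left (fApp_le _ _)

/-- The inclusion `[n - q] → [n]`, `c ↦ c + q`, of a final segment (clamped). -/
def tail (n q : ℕ) : Fin (n - q + 1) →o Fin (n + 1) where
  toFun i := ⟨min ((i : ℕ) + q) n, by omega⟩
  monotone' := by
    intro a b hab
    have h : (a : ℕ) ≤ (b : ℕ) := hab
    simp only [Fin.mk_le_mk]
    omega

theorem fApp_tail {n q w : ℕ} (h : w ≤ n - q) : fApp (tail n q) w = min (w + q) n := by
  rw [fApp_of_le _ h]; rfl

/-- The entries of a family of tuples, extended by `1`. -/
def entry {n : ℕ} (x : ∀ q : Fin (n + 1), ngObj G (q : ℕ) (n - (q : ℕ))) (q i : ℕ) :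
    G.obj (n - q) :=
  if h : q < n + 1 ∧ i < q then x ⟨q, h.1⟩ ⟨i, h.2⟩ else 1

theorem entry_of_lt {n : ℕ} (x : ∀ q : Fin (n + 1), ngObj G (q : ℕ) (n - (q : ℕ))) {q i : ℕ}
    (hq : q < n + 1) (hi : i < q) : entry x q i = x ⟨q, hq⟩ ⟨i, hi⟩ :=
  dif_pos ⟨hq, hi⟩

theorem entry_succ {n : ℕ} {x : ∀ q : Fin (n + 1), ngObj G (q : ℕ) (n - (q : ℕ))}
    (hx : ngTotCond G n x) {q i : ℕ} (hq : q + 1 ≤ n) (hi : i < q) :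
    entry x (q + 1) i = G.map (δOH 0 (n - (q + 1)) (n - q)) (entry x q i) := by
  have h := congrFun (hx q hq) ⟨i, hi⟩
  have h1 : ((δOH (q + 1) q (q + 1) (Fin.castSucc ⟨i, hi⟩) : Fin (q + 1 + 1)) : ℕ) = i := by
    change min (if i < q + 1 then i else i + 1) (q + 1) = i
    split_ifs <;> omega
  have h2 : ((δOH (q + 1) q (q + 1) (Fin.succ ⟨i, hi⟩) : Fin (q + 1 + 1)) : ℕ) = i + 1 := by
    change min (if i + 1 < q + 1 then i + 1 else i + 1 + 1) (q + 1) = i + 1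
    split_ifs <;> omega
  simp only [ngMap] at h
  rw [h1, h2] at h
  simp only [OrderHom.id_coe, id, Fin.val_castSucc, Fin.val_succ] at h
  rw [dProd_singleton, dProd_singleton, G.map_id, dif_pos (by omega), dif_pos hi] at h
  rw [entry_of_lt x (by omega) (by omega), entry_of_lt x (by omega) hi]
  exact h

theorem entry_eq_map {n : ℕ} {x : ∀ q : Fin (n + 1), ngObj G (q : ℕ) (n - (q : ℕ))}
    (hx : ngTotCond G n x) {p q i : ℕ} (hpq : p ≤ q) (hq : q ≤ n) (hi : i < p) :
    entry x q i = G.map (final n q p) (entry x p i) := by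
  induction q, hpq using Nat.le_induction with
  | base =>
    rw [G.map_congr (β := OrderHom.id) fun w hw => by
      rw [fApp_final hw, fApp_id hw]; omega, G.map_id]
  | succ q hpq ih =>
    rw [entry_succ hx hq (by omega), ih (by omega)]
    refine G.map_map_eq (fun w hw => ?_) _
    rw [fApp_final (fApp_le _ _), fApp_final hw, fApp_δOH hw]
    simp only [Nat.not_lt_zero, if_false]
    omega

/-- The family of local sections of an element of `Tot (NG)`, normalised at the vertex `0`. -/
def sections {n : ℕ} (x : ∀ q : Fin (n + 1), ngObj G (q : ℕ) (n - (q : ℕ))) (v : ℕ) : G.obj n :=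
  G.map (collapse n v) (dProd (entry x v) 0 v)⁻¹

theorem sections_zero {n : ℕ} (x : ∀ q : Fin (n + 1), ngObj G (q : ℕ) (n - (q : ℕ))) :
    sections x 0 = 1 := by
  rw [sections, dProd_of_le _ le_rfl, inv_one, G.map_one']

theorem map_tail_sections {n : ℕ} {x : ∀ q : Fin (n + 1), ngObj G (q : ℕ) (n - (q : ℕ))}
    (hx : ngTotCond G n x) {p q : ℕ} (hpq : p ≤ q) (hq : q ≤ n) :
    G.map (tail n q) (sections x p) = (dProd (entry x q) 0 p)⁻¹ := by
  rw [sections, G.map_map_eq (ε := final n q p), G.map_inv', G.map_dProd']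
  · exact congrArg _ (dProd_congr fun i _ hi => (entry_eq_map hx hpq hq hi).symm)
  · intro w hw
    rw [fApp_collapse (fApp_le _ _), fApp_tail hw, fApp_final hw]
    omega

theorem entry_eq_sections {n : ℕ} {x : ∀ q : Fin (n + 1), ngObj G (q : ℕ) (n - (q : ℕ))}
    (hx : ngTotCond G n x) {q i : ℕ} (hi : i < q) (hq : q ≤ n) :
    entry x q i =
      (G.map (tail n q) (sections x (i + 1)))⁻¹ * G.map (tail n q) (sections x i) := by
  rw [map_tail_sections hx hi hq, map_tail_sections hx hi.le hq, dProd_succ _ (Nat.zero_le i)]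
  group

theorem eq_of_agree_sections {n : ℕ} {x x' : ∀ q : Fin (n + 1), ngObj G (q : ℕ) (n - (q : ℕ))}
    (hx : ngTotCond G n x) (hx' : ngTotCond G n x') (h : Agree (sections x) (sections x')) :
    x = x' := by
  funext q i
  have key : ∀ v ≤ (q : ℕ),
      G.map (tail n q) (sections x v) = G.map (tail n q) (sections x' v) := by
    refine fun v hv => h v _ _ fun w hw => ?_
    rw [fApp_tail hw]
    omega
  have hq : (q : ℕ) ≤ n := by omega
  have h1 := entry_eq_sections hx i.isLt hq
  have h2 := entry_eq_sections hx' i.isLt hq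
  rw [key _ i.isLt, key _ i.isLt.le, ← h2, entry_of_lt x q.isLt i.isLt,
    entry_of_lt x' q.isLt i.isLt] at h1
  exact h1

/-- The entries of the image of an element of `Tot (NG)` under a structure map. -/
theorem entry_ngTotRaw {m n : ℕ} (θ : Fin (m + 1) →o Fin (n + 1))
    (x : ∀ q : Fin (n + 1), ngObj G (q : ℕ) (n - (q : ℕ))) (p : Fin (m + 1)) {i : ℕ}
    (hi : i < (p : ℕ)) :
    entry (ngTotRaw G θ x) p i =
      dProd (fun j => G.map (splGe θ p) (entry x (θ p) j)) (fApp θ i) (fApp θ (i + 1)) := by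
  rw [entry_of_lt _ p.isLt hi]
  change dProd _ (fApp θ i) (fApp θ (i + 1)) = _
  have hle : fApp θ (i + 1) ≤ (θ p : ℕ) := (fApp_mono θ hi).trans_eq (fApp_coe θ p)
  refine dProd_congr fun j _ hj => ?_
  have hj' : j < (θ p : ℕ) := by omega
  rw [entry_of_lt x (θ p).isLt hj']
  exact congrArg _ (dif_pos hj')

theorem agree_sections_ngTotRaw {m n : ℕ} (θ : Fin (m + 1) →o Fin (n + 1))
    {x : ∀ q : Fin (n + 1), ngObj G (q : ℕ) (n - (q : ℕ))} (hx : ngTotCond G n x) :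
    Agree (sections (ngTotRaw G θ x))
      (fun v => (G.map θ (sections x (fApp θ 0)))⁻¹ * pull θ (sections x) v) := by
  intro v l φ hφ
  have hvm : v < m + 1 := by
    have h1 := hφ 0 (Nat.zero_le _)
    have h2 := fApp_le φ 0
    omega
  set p : Fin (m + 1) := ⟨v, hvm⟩ with hp
  have hpv : (p : ℕ) = v := rfl
  have hθp : fApp θ v = (θ p : ℕ) := fApp_coe θ p
  set h : ℕ → G.obj (m - v) := fun i =>
    G.map (splGe θ p) (G.map (tail n (θ p)) (sections x (fApp θ i))) with hh
  have hprod : dProd (entry (ngTotRaw G θ x) v) 0 v = (h v)⁻¹ * h 0 := by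
    refine dProd_telescope (Nat.zero_le v) fun i _ hi => ?_
    refine (entry_ngTotRaw θ x p hi).trans ?_
    rw [← G.map_dProd',
      dProd_telescope (h := fun j => G.map (tail n (θ p)) (sections x j))
        (fApp_mono θ (Nat.le_succ i))
        fun j _ hj => entry_eq_sections hx
          (lt_of_lt_of_le hj (by rw [← hθp]; exact fApp_mono θ hi)) (by omega),
      G.map_mul, G.map_inv']
  have hmap : ∀ z : G.obj n,
      G.map φ (G.map (collapse m v) (G.map (splGe θ p) (G.map (tail n (θ p)) z))) =
        G.map φ (G.map θ z) := by
    intro z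
    rw [G.map_comp (splGe θ p), G.map_comp (collapse m v)]
    refine G.map_map_congr (fun w hw => ?_) z
    have h1 := hφ w hw
    have h2 := fApp_le φ w
    have h3 := fApp_mono θ h1
    have h4 := fApp_le θ (fApp φ w)
    rw [fApp_comp, fApp_comp, fApp_collapse h2, fApp_tail (fApp_le _ _),
      fApp_splGe θ p (by simp only [hpv]; omega), hpv, hθp, Nat.sub_add_cancel h1]
    omega
  rw [show sections (ngTotRaw G θ x) v =
    G.map (collapse m v) (dProd (entry (ngTotRaw G θ x) v) 0 v)⁻¹ from rfl, hprod]
  simp only [hh, mul_inv_rev, inv_inv, G.map_mul, G.map_inv']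
  rw [hmap, hmap]
  rfl

/-- The element of `Tot (NG)` of transitions between the members of a family. -/
def transitions {n : ℕ} (s : ℕ → G.obj n) (q : Fin (n + 1)) : ngObj G (q : ℕ) (n - (q : ℕ)) :=
  fun i => G.map (tail n q) ((s (i + 1))⁻¹ * s i)

theorem ngTotCond_transitions {n : ℕ} (s : ℕ → G.obj n) : ngTotCond G n (transitions s) := by
  intro q hq
  funext i
  obtain ⟨i, hi⟩ := i
  have h1 : ((δOH (q + 1) q (q + 1) (Fin.castSucc ⟨i, hi⟩) : Fin (q + 1 + 1)) : ℕ) = i := by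
    change min (if i < q + 1 then i else i + 1) (q + 1) = i
    split_ifs <;> omega
  have h2 : ((δOH (q + 1) q (q + 1) (Fin.succ ⟨i, hi⟩) : Fin (q + 1 + 1)) : ℕ) = i + 1 := by
    change min (if i + 1 < q + 1 then i + 1 else i + 1 + 1) (q + 1) = i + 1
    split_ifs <;> omega
  simp only [ngMap]
  rw [h1, h2]
  simp only [OrderHom.id_coe, id, Fin.val_castSucc, Fin.val_succ]
  rw [dProd_singleton, dProd_singleton, G.map_id, dif_pos (by omega), dif_pos hi]
  refine (G.map_map_eq (fun w hw => ?_) _).symm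
  rw [fApp_tail hw, fApp_tail (fApp_le _ _), fApp_δOH hw]
  simp only [Nat.not_lt_zero, if_false]
  omega

theorem agree_sections_transitions {n : ℕ} (s : ℕ → G.obj n) :
    Agree (sections (transitions s)) (fun v => (s 0)⁻¹ * s v) := by
  intro v l φ hφ
  have hvn : v < n + 1 := by
    have h1 := hφ 0 (Nat.zero_le _)
    have h2 := fApp_le φ 0
    omega
  have hprod : dProd (entry (transitions s) v) 0 v =
      (G.map (tail n v) (s v))⁻¹ * G.map (tail n v) (s 0) := by
    refine dProd_telescope (h := fun j => G.map (tail n v) (s j)) (Nat.zero_le v)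
      fun i _ hi => ?_
    rw [entry_of_lt _ hvn hi, transitions, G.map_mul, G.map_inv']
  rw [sections, hprod, ← G.map_inv', ← G.map_mul, ← G.map_inv', mul_inv_rev, inv_inv,
    G.map_comp (collapse n v)]
  refine G.map_map_eq (fun w hw => ?_) _
  have h1 := hφ w hw
  have h2 := fApp_le φ w
  rw [fApp_comp, fApp_collapse h2, fApp_tail (by omega)]
  omega

/-- The element of `W̄G` defined by a family of local sections. -/
def wbarOf {n : ℕ} (s : ℕ → G.obj n) : G.WbarN n :=
  fun j => (G.map (initial j (j + 1)) (glueAt (j + 1) s))⁻¹ * glueAt j s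

theorem Agree.wbarOf_eq {n : ℕ} {s s' : ℕ → G.obj n} (h : Agree s s') : wbarOf s = wbarOf s' := by
  funext j
  rw [wbarOf, wbarOf, h.glueAt_eq, h.glueAt_eq]

theorem map_initial_initial {v n : ℕ} (hv : v + 1 ≤ n) (a : G.obj n) :
    G.map (initial v (v + 1)) (G.map (initial (v + 1) n) a) = G.map (initial v n) a := by
  refine G.map_map_eq (fun w hw => ?_) a
  rw [fApp_initial (fApp_le _ _), fApp_initial hw, fApp_initial hw]
  omega

theorem wbarOf_mul {n : ℕ} (a : G.obj n) (s : ℕ → G.obj n) :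
    wbarOf (fun v => a * s v) = wbarOf s := by
  funext j
  have hj := j.isLt
  rw [wbarOf, wbarOf, glueAt_mul, glueAt_mul, G.map_mul, map_initial_initial (by omega)]
  group

theorem wbarMap_wbarOf {m n : ℕ} (θ : Fin (m + 1) →o Fin (n + 1)) (s : ℕ → G.obj n) :
    G.wbarMap θ (wbarOf s) = wbarOf (pull θ s) := by
  funext i
  have hi := i.isLt
  have h1 : ((θ i.castSucc : Fin (n + 1)) : ℕ) = fApp θ i := (fApp_coe θ i.castSucc).symm
  have h2 : ((θ i.succ : Fin (n + 1)) : ℕ) = fApp θ (i + 1) := (fApp_coe θ i.succ).symm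
  have hmono : fApp θ i ≤ fApp θ (i + 1) := fApp_mono θ (Nat.le_succ i)
  rw [wbarMap, h1, h2, dProd_telescope
    (h := fun j => G.map (restrictOH θ i j) (glueAt j s)) hmono, wbarOf,
    glueAt_pull (by omega), glueAt_pull (by omega)]
  · congr 2
    refine (G.map_map_eq (fun w hw => ?_) _).symm
    rw [fApp_restrictOH _ (fApp_le _ _), fApp_restrictOH _ hw, fApp_initial hw,
      min_eq_left (show w ≤ (i : ℕ) + 1 by omega)]
  · intro j hj hj'
    have hjn : j < n := by have := fApp_le θ (i + 1); omega
    rw [gE, dif_pos hjn, wbarOf, G.map_mul, G.map_inv']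
    congr 2
    refine G.map_map_eq (fun w hw => ?_) _
    have := fApp_mono θ hw
    rw [fApp_initial (fApp_le _ _), fApp_restrictOH _ hw, fApp_restrictOH _ hw]
    omega

/-- The comparison map from `Tot (NG)` to `W̄G` in dimension `n`. -/
def totToWbar (G : SGrp) (n : ℕ)
    (x : {x : ∀ q : Fin (n + 1), ngObj G (q : ℕ) (n - (q : ℕ)) // ngTotCond G n x}) :
    G.WbarN n :=
  wbarOf (sections x.1)

theorem totToWbar_injective (n : ℕ) : Function.Injective (totToWbar G n) := by
  rintro ⟨x, hx⟩ ⟨x', hx'⟩ h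
  set s := sections x with hs
  set s' := sections x' with hs'
  have hW : ∀ j : Fin n, wbarOf s j = wbarOf s' j := fun j => congrFun h j
  set a := glueAt n s' * (glueAt n s)⁻¹ with ha
  have key : ∀ v ≤ n, glueAt v s' = G.map (initial v n) a * glueAt v s := by
    intro v hv
    induction hv using Nat.decreasingInduction with
    | self =>
      rw [G.map_congr (β := OrderHom.id) fun w hw => by
        rw [fApp_initial hw, fApp_id hw, min_eq_left hw], G.map_id, ha, inv_mul_cancel_right]
    | of_succ v hv ih =>
      have h1 := hW ⟨v, hv⟩
      simp only [wbarOf] at h1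
      rw [ih, G.map_mul, map_initial_initial hv, mul_inv_rev, mul_assoc] at h1
      rw [mul_left_cancel h1, mul_inv_cancel_left]
  have hagree : Agree s' fun v => a * s v := agree_of_glueAt fun v hv => by
    rw [glueAt_mul, key v hv]
  have ha1 : a = 1 := by
    have := hagree.zero
    rw [hs, hs', sections_zero, sections_zero, mul_one] at this
    exact this.symm
  simp only [ha1, one_mul] at hagree
  exact Subtype.ext (eq_of_agree_sections hx hx' hagree.symm)

theorem totToWbar_surjective (n : ℕ) : Function.Surjective (totToWbar G n) := by
  intro g
  obtain ⟨s, hs⟩ := exists_glueAt_eq n fun v =>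
    dProd (fun j => G.map (initial v j) (G.gE g j)) v n
  refine ⟨⟨transitions s, ngTotCond_transitions s⟩, ?_⟩
  rw [totToWbar, (agree_sections_transitions s).wbarOf_eq, wbarOf_mul]
  funext j
  have hj := j.isLt
  rw [wbarOf, hs _ (by omega), hs _ (by omega),
    ← dProd_mul_dProd _ (Nat.le_succ (j : ℕ)) hj, dProd_singleton, G.map_dProd',
    dProd_congr (g := fun i => G.map (initial j i) (G.gE g i)), inv_mul_cancel_left,
    G.map_congr (β := OrderHom.id), G.map_id, gE, dif_pos hj]
  · intro w hw
    rw [fApp_initial hw, fApp_id hw, min_eq_left hw]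
  · intro i hi _
    refine G.map_map_eq (fun w hw => ?_) _
    rw [fApp_initial (fApp_le _ _), fApp_initial hw, fApp_initial hw]
    omega

end SGrp

namespace SGrpHom

open SGrp

variable {G H : SGrp} (f : SGrpHom G H)

/-- A component of a morphism of simplicial groups, as a homomorphism. -/
def appHom (n : ℕ) : G.obj n →* H.obj n := MonoidHom.mk' (f.app n) (f.mul n)

theorem app_one (n : ℕ) : f.app n 1 = 1 := map_one (f.appHom n)

theorem app_inv {n : ℕ} (x : G.obj n) : f.app n x⁻¹ = (f.app n x)⁻¹ := map_inv (f.appHom n) x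

theorem app_correct {n : ℕ} (y : ℕ → G.obj (n - 1)) (x : G.obj n) (k : ℕ) :
    f.app n (correct y x k) = correct (fun i => f.app (n - 1) (y i)) (f.app n x) k := by
  induction k with
  | zero => rfl
  | succ k ih =>
    rw [correct_succ, correct_succ, f.mul, degen, degen, f.comm, f.mul, f.app_inv, ← ih,
      face, face, f.comm]

theorem app_pull {m n : ℕ} (θ : Fin (m + 1) →o Fin (n + 1)) (s : ℕ → G.obj n) :
    (fun v => f.app m (pull θ s v)) = pull θ fun v => f.app n (s v) := by
  funext v
  exact f.comm θ _

theorem app_glue {n : ℕ} (s : ℕ → G.obj n) :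
    f.app n (glue n s) = glue n fun v => f.app n (s v) := by
  induction n with
  | zero => rfl
  | succ n ih =>
    rw [glue_succ, glue_succ, app_correct]
    refine correct_congr _ fun k _ => ?_
    rw [← app_pull]
    exact ih _

theorem app_glueAt {n : ℕ} (v : ℕ) (s : ℕ → G.obj n) :
    f.app v (glueAt v s) = glueAt v fun w => f.app n (s w) := by
  rw [glueAt, app_glue, app_pull, glueAt]

theorem app_wbarOf {n : ℕ} (s : ℕ → G.obj n) (j : Fin n) :
    f.app j (wbarOf s j) = wbarOf (fun v => f.app n (s v)) j := by
  rw [wbarOf, wbarOf, f.mul, f.app_inv, f.comm, app_glueAt, app_glueAt]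

theorem app_sections {n : ℕ} (x : ∀ q : Fin (n + 1), ngObj G (q : ℕ) (n - (q : ℕ))) (v : ℕ) :
    f.app n (sections x v) = sections (fun q i => f.app (n - (q : ℕ)) (x q i)) v := by
  have hentry : ∀ i, f.app (n - v) (entry x v i) =
      entry (fun q i => f.app (n - (q : ℕ)) (x q i)) v i := by
    intro i
    unfold entry
    split_ifs
    · rfl
    · exact f.app_one _
  simp only [sections]
  rw [f.comm, f.app_inv]
  refine congrArg _ (congrArg _ ((map_dProd (f.appHom (n - v)) _ _ _).trans ?_))
  exact dProd_congr fun i _ _ => hentry i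

end SGrpHom

end Paper

open Paper Paper.SGrp in
/-- for every simplicial group `G` there is a natural isomorphism of
simplicial sets `W̄G ≅ Tot(NG)` (stated here in the direction `Tot(NG) ≅ W̄G`):
there is a family of bijections in each dimension, compatible with all simplicial
structure maps, and natural in `G`. -/
theorem stmt_6 :
    ∃ E : ∀ (G : SGrp) (n : ℕ),
        {x : ∀ q : Fin (n+1), ngObj G (q:ℕ) (n - (q:ℕ)) // ngTotCond G n x} ≃ G.WbarN n,
      (∀ (G : SGrp) {m n : ℕ} (θ : Fin (m+1) →o Fin (n+1))
          (x : {x : ∀ q : Fin (n+1), ngObj G (q:ℕ) (n - (q:ℕ)) // ngTotCond G n x})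
          (h : ngTotCond G m (ngTotRaw G θ x.1)),
          G.wbarMap θ (E G n x) = E G m ⟨ngTotRaw G θ x.1, h⟩) ∧
      (∀ (G G' : SGrp) (f : SGrpHom G G') (n : ℕ)
          (x : {x : ∀ q : Fin (n+1), ngObj G (q:ℕ) (n - (q:ℕ)) // ngTotCond G n x})
          (h : ngTotCond G' n (fun q i => f.app (n - (q:ℕ)) (x.1 q i))),
          (fun j : Fin n => f.app (j:ℕ) (E G n x j)) =
            E G' n ⟨fun q i => f.app (n - (q:ℕ)) (x.1 q i), h⟩) := by
  refine ⟨fun G n => Equiv.ofBijective (totToWbar G n)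
    ⟨totToWbar_injective n, totToWbar_surjective n⟩, ?_, ?_⟩
  · intro G m n θ x h
    change G.wbarMap θ (wbarOf (sections x.1)) = wbarOf (sections (ngTotRaw G θ x.1))
    rw [wbarMap_wbarOf, (agree_sections_ngTotRaw θ x.2).wbarOf_eq, wbarOf_mul]
  · intro G G' f n x h
    funext j
    change f.app j (wbarOf (sections x.1) j) = wbarOf (sections _) j
    rw [f.app_wbarOf]
    congr 1
    funext v
    exact f.app_sections x.1 v
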